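/- Let T be a finite tree of order at least 2 that is not a path. Then dim(T) = ℓ'(T) − |S'(T)| if and only if every exterior major vertex u of T with terminal degree at least 2 is the support vertex of each of its terminal vertices (i.e., u is adjacent to each of its terminal vertices). -/

import Mathlib

open SimpleGraph

variable {V : Type*}

/-- `S` is a resolving set of `G`. -/
def isResolvingSet (G : SimpleGraph V) (S : Set V) : Prop :=
  ∀ x y : V, x ≠ y → ∃ u ∈ S, G.dist u x ≠ G.dist u y

/-- `S` is a dominating set of `G`. -/
def isDominatingSet (G : SimpleGraph V) (S : Set V) : Prop :=
  ∀ x : V, x ∉ S → ∃ u ∈ S, G.Adj u x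

/-- `S` is a metric-locating-dominating set of `G`. -/
def isMLDSet (G : SimpleGraph V) (S : Set V) : Prop :=
  isResolvingSet G S ∧ isDominatingSet G S

/-- `S` is a locating-dominating set of `G`. -/
def isLDSet (G : SimpleGraph V) (S : Set V) : Prop :=
  isDominatingSet G S ∧
    ∀ x ∉ S, ∀ y ∉ S, x ≠ y → G.neighborSet x ∩ S ≠ G.neighborSet y ∩ S

/-- vertices `u` and `v` doubly resolve the pair `{x, y}`. -/
def doublyResolves (G : SimpleGraph V) (u v x y : V) : Prop :=
  (G.dist u x : ℤ) - (G.dist u y : ℤ) ≠ (G.dist v x : ℤ) - (G.dist v y : ℤ)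

/-- the set `S` doubly resolves the pair `{x, y}`. -/
def setDoublyResolves (G : SimpleGraph V) (S : Set V) (x y : V) : Prop :=
  ∃ u ∈ S, ∃ v ∈ S, doublyResolves G u v x y

/-- `S` is a doubly resolving set of `G`. -/
def isDoublyResolvingSet (G : SimpleGraph V) (S : Set V) : Prop :=
  ∀ x y : V, x ≠ y → setDoublyResolves G S x y

/-- the metric dimension `dim G`. -/
noncomputable def metricDim (G : SimpleGraph V) : ℕ :=
  sInf {n | ∃ S : Set V, isResolvingSet G S ∧ S.ncard = n}

/-- the domination number `γ(G)`. -/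
noncomputable def domNum (G : SimpleGraph V) : ℕ :=
  sInf {n | ∃ S : Set V, isDominatingSet G S ∧ S.ncard = n}

/-- the metric-location-domination number `γ_M(G)`. -/
noncomputable def mldNum (G : SimpleGraph V) : ℕ :=
  sInf {n | ∃ S : Set V, isMLDSet G S ∧ S.ncard = n}

/-- the location-domination number `γ_L(G)`. -/
noncomputable def ldNum (G : SimpleGraph V) : ℕ :=
  sInf {n | ∃ S : Set V, isLDSet G S ∧ S.ncard = n}

/-- the minimum cardinality `ψ(G)` of a doubly resolving set. -/
noncomputable def psiNum (G : SimpleGraph V) : ℕ :=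
  sInf {n | ∃ S : Set V, isDoublyResolvingSet G S ∧ S.ncard = n}

/-- a leaf: a vertex of degree 1. -/
def isLeaf (G : SimpleGraph V) (x : V) : Prop := (G.neighborSet x).ncard = 1

/-- a support vertex: a vertex adjacent to some leaf. -/
def isSupport (G : SimpleGraph V) (u : V) : Prop := ∃ x, isLeaf G x ∧ G.Adj u x

/-- a strong support vertex: a vertex adjacent to at least two leaves. -/
def isStrongSupport (G : SimpleGraph V) (u : V) : Prop :=
  2 ≤ {x | isLeaf G x ∧ G.Adj u x}.ncard

/-- `ℓ(G)`: the number of leaves. -/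
noncomputable def numLeaves (G : SimpleGraph V) : ℕ := {x | isLeaf G x}.ncard

/-- `ℓ'(G)`: the number of leaves adjacent to a strong support vertex. -/
noncomputable def numStrongLeaves (G : SimpleGraph V) : ℕ :=
  {x | isLeaf G x ∧ ∃ u, isStrongSupport G u ∧ G.Adj u x}.ncard

/-- a major vertex: a vertex of degree at least 3. -/
def isMajor (G : SimpleGraph V) (u : V) : Prop := 3 ≤ (G.neighborSet u).ncard

/-- `x` is a terminal vertex of the major vertex `u`:
`x` is a leaf and `u` is the major vertex closest to `x`. -/
def isTerminalOf (G : SimpleGraph V) (u x : V) : Prop :=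
  isLeaf G x ∧ isMajor G u ∧ ∀ w, isMajor G w → w ≠ u → G.dist u x < G.dist w x

/-- the terminal degree `ter(u)` of `u`. -/
noncomputable def terDeg (G : SimpleGraph V) (u : V) : ℕ :=
  {x | isTerminalOf G u x}.ncard

/-- `G` is (isomorphic to) a path graph. -/
def isPathGraph (G : SimpleGraph V) : Prop :=
  ∃ n : ℕ, Nonempty (G ≃g SimpleGraph.pathGraph n)

namespace SimpleGraph

section Degree

variable {V : Type*} {G : SimpleGraph V}

lemma isLeaf.eq_of_adj {x a b : V} (hx : isLeaf G x) (ha : G.Adj x a) (hb : G.Adj x b) :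
    a = b := by
  obtain ⟨c, hc⟩ := Set.ncard_eq_one.1 hx
  have ha' : a ∈ G.neighborSet x := ha
  have hb' : b ∈ G.neighborSet x := hb
  rw [hc] at ha' hb'
  exact ha'.trans hb'.symm

lemma isMajor_of_adj [Finite V] {v a b c : V} (ha : G.Adj v a) (hb : G.Adj v b) (hc : G.Adj v c)
    (hab : a ≠ b) (hac : a ≠ c) (hbc : b ≠ c) : isMajor G v :=
  (Set.two_lt_ncard_iff).2 ⟨a, b, c, ha, hb, hc, hab, hac, hbc⟩

lemma isMajor.not_isLeaf {v : V} (hv : isMajor G v) : ¬ isLeaf G v := by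
  unfold isMajor at hv
  unfold isLeaf
  omega

/-- A major vertex has two neighbours other than a given vertex. -/
lemma isMajor.exists_adj_ne [Finite V] {v : V} (hv : isMajor G v) (p : V) :
    ∃ a b, G.Adj v a ∧ G.Adj v b ∧ a ≠ b ∧ a ≠ p ∧ b ≠ p := by
  obtain ⟨a, b, c, ha, hb, hc, hab, hac, hbc⟩ :=
    (Set.two_lt_ncard_iff).1 hv
  simp only [mem_neighborSet] at ha hb hc
  by_cases h1 : a = p
  · exact ⟨b, c, hb, hc, hbc, by rintro rfl; exact hab h1, by rintro rfl; exact hac h1⟩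
  by_cases h2 : b = p
  · exact ⟨a, c, ha, hc, hac, h1, by rintro rfl; exact hbc h2⟩
  exact ⟨a, b, ha, hb, hab, h1, h2⟩

lemma isTerminalOf.unique {u v x : V} (hu : isTerminalOf G u x) (hv : isTerminalOf G v x) :
    u = v := by
  by_contra h
  have h1 := hu.2.2 v hv.2.1 (Ne.symm h)
  have h2 := hv.2.2 u hu.2.1 h
  omega

lemma isLeaf_of_forall_adj {z a : V} (ha : G.Adj z a) (h : ∀ b, G.Adj z b → b = a) :
    isLeaf G z := by
  refine Set.ncard_eq_one.2 ⟨a, ?_⟩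
  ext b
  exact ⟨fun hb => h b hb, fun hb => by rw [Set.mem_singleton_iff.1 hb]; exact ha⟩

end Degree

section Distance

variable {V : Type*} {G : SimpleGraph V}

lemma Reachable.mem_of_closed {a b : V} (h : G.Reachable a b) {C : Set V}
    (hC : ∀ v ∈ C, ∀ w, G.Adj v w → w ∈ C) (ha : a ∈ C) : b ∈ C := by
  obtain ⟨p⟩ := h
  induction p with
  | nil => exact ha
  | cons hadj _ ih => exact ih (hC _ ha _ hadj)

lemma Connected.dist_le_succ_of_adj (hG : G.Connected) (r : V) {a b : V} (h : G.Adj a b) :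
    G.dist r b ≤ G.dist r a + 1 := by
  have h1 := hG.dist_triangle (u := r) (v := a) (w := b)
  rwa [dist_eq_one_iff_adj.2 h] at h1

lemma Connected.exists_adj_dist_eq (hG : G.Connected) {r v : V} (h : v ≠ r) :
    ∃ a, G.Adj v a ∧ G.dist r v = G.dist r a + 1 := by
  obtain ⟨p, hp⟩ := hG.exists_walk_length_eq_dist v r
  cases p with
  | nil => exact absurd rfl h
  | @cons _ a _ hadj q =>
    refine ⟨a, hadj, ?_⟩
    have h1 := dist_le q
    have h2 := hG.dist_le_succ_of_adj r hadj.symm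
    rw [Walk.length_cons, dist_comm] at hp
    rw [dist_comm] at h1
    omega

lemma IsTree.eq_of_dist_eq (hG : G.IsTree) {r v a b : V} (ha : G.Adj v a) (hb : G.Adj v b)
    (hda : G.dist r v = G.dist r a + 1) (hdb : G.dist r v = G.dist r b + 1) : a = b := by
  obtain ⟨p, hp⟩ := hG.connected.exists_walk_length_eq_dist r a
  obtain ⟨q, hq⟩ := hG.connected.exists_walk_length_eq_dist r b
  have h1 : (p.concat ha.symm).IsPath :=
    Walk.isPath_of_length_eq_dist _ (by rw [Walk.length_concat]; omega)
  have h2 : (q.concat hb.symm).IsPath :=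
    Walk.isPath_of_length_eq_dist _ (by rw [Walk.length_concat]; omega)
  have h3 := (hG.existsUnique_path r v).unique h1 h2
  have h4 := congrArg Walk.penultimate h3
  simpa using h4

lemma Connected.exists_boundary_dist_eq (hG : G.Connected) {C : Set V} {s z : V}
    (hs : s ∉ C) (hz : z ∈ C) :
    ∃ a b, G.Adj a b ∧ a ∉ C ∧ b ∈ C ∧ G.dist s z = G.dist s a + G.dist a z := by
  classical
  obtain ⟨p, hp⟩ := hG.exists_walk_length_eq_dist s z
  obtain ⟨d, hd, h1, h2⟩ := p.exists_boundary_dart Cᶜ hs (by simpa using hz)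
  refine ⟨d.fst, d.snd, d.adj, h1, by simpa using h2, ?_⟩
  have hmem := p.dart_fst_mem_support_of_mem_darts hd
  have h3 := congrArg Walk.length (p.take_spec hmem)
  rw [Walk.length_append] at h3
  have h4 := dist_le (p.takeUntil _ hmem)
  have h5 := dist_le (p.dropUntil _ hmem)
  have h6 := hG.dist_triangle (u := s) (v := d.fst) (w := z)
  omega

/-- For adjacent `p` and `w`, the vertices on the side of `w`. -/
def branch (G : SimpleGraph V) (p w : V) : Set V := {v | G.dist p v = G.dist w v + 1}

lemma mem_branch {p w v : V} : v ∈ branch G p w ↔ G.dist p v = G.dist w v + 1 := Iff.rfl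

lemma IsTree.dist_eq_of_not_mem_branch (hG : G.IsTree) {p w v : V} (h : G.Adj p w)
    (hv : v ∉ branch G p w) : G.dist w v = G.dist p v + 1 := by
  have h1 := hG.dist_eq_dist_add_one_of_adj v h
  rw [mem_branch] at hv
  rw [dist_comm (u := v), dist_comm (u := v)] at h1
  tauto

/-- An edge of a tree separates its two sides. -/
lemma IsTree.dist_eq_of_mem_branch (hG : G.IsTree) {p w v z : V} (h : G.Adj p w)
    (hv : v ∉ branch G p w) (hz : z ∈ branch G p w) :
    G.dist v z = G.dist v p + G.dist p z := by
  obtain ⟨a, b, hab, ha, hb, hd⟩ := hG.connected.exists_boundary_dist_eq hv hz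
  suffices a = p by rw [this] at hd; exact hd
  by_contra hne
  have h1 := hG.dist_eq_of_not_mem_branch h ha
  rw [mem_branch] at hb
  have h2 := hG.connected.dist_le_succ_of_adj w hab.symm
  have h3 := hG.connected.dist_le_succ_of_adj p hab
  obtain ⟨a', ha', hda'⟩ := hG.connected.exists_adj_dist_eq hne
  have h6 := hG.dist_eq_dist_add_one_of_adj w ha'
  have h7 := hG.connected.dist_le_succ_of_adj a' h
  rw [dist_comm (u := a') (v := w), dist_comm (u := a') (v := p)] at h7
  have h8 : a' = b := hG.eq_of_dist_eq (r := w) ha' hab (by omega) (by omega)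
  subst h8
  omega

lemma self_mem_branch {p w : V} (h : G.Adj p w) : w ∈ branch G p w := by
  rw [mem_branch, dist_eq_one_iff_adj.2 h, dist_self]

lemma IsTree.disjoint_branch (hG : G.IsTree) {p w₁ w₂ z : V} (h₁ : G.Adj p w₁)
    (h₂ : G.Adj p w₂) (hne : w₁ ≠ w₂) (hz₁ : z ∈ branch G p w₁) : z ∉ branch G p w₂ := by
  intro hz₂
  rw [mem_branch, dist_comm, dist_comm (u := w₁)] at hz₁
  rw [mem_branch, dist_comm, dist_comm (u := w₂)] at hz₂
  exact hne (hG.eq_of_dist_eq h₁ h₂ hz₁ hz₂)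

lemma isMajor.isTerminalOf_of_adj (hG : G.Connected) {u x : V} (hu : isMajor G u)
    (hx : isLeaf G x) (hux : G.Adj u x) : isTerminalOf G u x := by
  refine ⟨hx, hu, fun w hw hwu => ?_⟩
  rw [dist_eq_one_iff_adj.2 hux]
  refine hG.one_lt_dist_of_ne_of_not_adj ?_ fun h => hwu (hx.eq_of_adj h.symm hux.symm)
  rintro rfl
  exact hw.not_isLeaf hx

end Distance

section Branches

variable {V : Type*} [Finite V] {G : SimpleGraph V}

/-- A branch without major vertices at a major vertex contains a terminal vertex of it. -/
lemma IsTree.exists_isTerminalOf_mem_branch (hG : G.IsTree) {m w : V} (hm : isMajor G m)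
    (h : G.Adj m w) (hno : ∀ q ∈ branch G m w, ¬ isMajor G q) :
    ∃ z ∈ branch G m w, isTerminalOf G m z := by
  obtain ⟨z, hz, hmax⟩ := Set.exists_max_image (branch G m w) (G.dist m) (Set.toFinite _)
    ⟨w, self_mem_branch h⟩
  have hzm : z ≠ m := by
    rintro rfl
    rw [mem_branch, dist_self] at hz
    omega
  obtain ⟨a, ha, hda⟩ := hG.connected.exists_adj_dist_eq hzm
  refine ⟨z, hz, isLeaf_of_forall_adj ha fun b hb => ?_, hm, fun q hq hqm => ?_⟩
  · rcases hG.dist_eq_dist_add_one_of_adj m hb with h1 | h1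
    · exact hG.eq_of_dist_eq hb ha h1 hda
    · have hb' : b ∈ branch G m w := by
        by_contra hb'
        have h2 := hG.dist_eq_of_not_mem_branch h hb'
        have h3 := hG.connected.dist_le_succ_of_adj w hb
        rw [mem_branch] at hz
        omega
      have := hmax b hb'
      omega
  · have h1 := hG.dist_eq_of_mem_branch h (fun hq' => hno q hq' hq) hz
    have h2 := hG.connected.pos_dist_of_ne hqm
    omega

/-- Two branches without major vertices at a major vertex contain a vertex of `S`. -/
lemma IsTree.exists_mem_of_branches (hG : G.IsTree) {S : Set V}
    (hcond : ∀ u x y, x ≠ y → isTerminalOf G u x → isTerminalOf G u y → G.Adj u x)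
    (hS : ∀ u x y, x ≠ y → isLeaf G x → isLeaf G y → G.Adj u x → G.Adj u y → x ∈ S ∨ y ∈ S)
    {m a b : V} (hm : isMajor G m) (ha : G.Adj m a) (hb : G.Adj m b) (hab : a ≠ b)
    (hna : ∀ q ∈ branch G m a, ¬ isMajor G q) (hnb : ∀ q ∈ branch G m b, ¬ isMajor G q) :
    ∃ s ∈ S, s ∈ branch G m a ∨ s ∈ branch G m b := by
  obtain ⟨x, hxa, hx⟩ := hG.exists_isTerminalOf_mem_branch hm ha hna
  obtain ⟨y, hyb, hy⟩ := hG.exists_isTerminalOf_mem_branch hm hb hnb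
  have hxy : x ≠ y := by
    rintro rfl
    exact hG.disjoint_branch ha hb hab hxa hyb
  rcases hS m x y hxy hx.1 hy.1 (hcond m x y hxy hx hy) (hcond m y x hxy.symm hy hx) with h | h
  · exact ⟨x, h, Or.inl hxa⟩
  · exact ⟨y, h, Or.inr hyb⟩

/-- A branch with a major vertex meets `S`. -/
lemma IsTree.exists_mem_branch (hG : G.IsTree) {S : Set V}
    (hcond : ∀ u x y, x ≠ y → isTerminalOf G u x → isTerminalOf G u y → G.Adj u x)
    (hS : ∀ u x y, x ≠ y → isLeaf G x → isLeaf G y → G.Adj u x → G.Adj u y → x ∈ S ∨ y ∈ S)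
    {p w q : V} (h : G.Adj p w) (hq : q ∈ branch G p w) (hqm : isMajor G q) :
    ∃ s ∈ S, s ∈ branch G p w := by
  obtain ⟨m, ⟨hmb, hm⟩, hmax⟩ := Set.exists_max_image {v | v ∈ branch G p w ∧ isMajor G v}
    (G.dist p) (Set.toFinite _) ⟨q, hq, hqm⟩
  have hmp : m ≠ p := by
    rintro rfl
    rw [mem_branch, dist_self] at hmb
    omega
  obtain ⟨e, he, hde⟩ := hG.connected.exists_adj_dist_eq hmp
  obtain ⟨a, b, ha, hb, hab, hae, hbe⟩ := hm.exists_adj_ne e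
  have key : ∀ c, G.Adj m c → c ≠ e → ∀ v ∈ branch G m c,
      v ∈ branch G p w ∧ G.dist p m < G.dist p v := by
    intro c hc hce v hv
    have h1 : G.dist p c = G.dist p m + 1 := by
      rcases hG.dist_eq_dist_add_one_of_adj p hc with h1 | h1
      · exact absurd (hG.eq_of_dist_eq hc he h1 hde) hce
      · exact h1
    have h3 := hG.connected.dist_le_succ_of_adj c h
    have hmb' := hmb
    rw [mem_branch] at hmb' hv
    rw [dist_comm (u := c), dist_comm (u := c)] at h3
    have h3' := hG.connected.dist_le_succ_of_adj c h.symm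
    rw [dist_comm (u := c), dist_comm (u := c)] at h3'
    have hp : p ∉ branch G m c := by
      rw [mem_branch, dist_comm, dist_comm (u := c)]
      omega
    have hw : w ∉ branch G m c := by
      rw [mem_branch, dist_comm, dist_comm (u := c)]
      omega
    have h4 := hG.dist_eq_of_mem_branch hc hp hv
    have h5 := hG.dist_eq_of_mem_branch hc hw hv
    rw [mem_branch]
    omega
  have hno : ∀ c, G.Adj m c → c ≠ e → ∀ v ∈ branch G m c, ¬ isMajor G v := by
    intro c hc hce v hv hvm
    obtain ⟨h1, h2⟩ := key c hc hce v hv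
    have := hmax v ⟨h1, hvm⟩
    omega
  obtain ⟨s, hs, h1 | h1⟩ :=
    hG.exists_mem_of_branches hcond hS hm ha hb hab (hno a ha hae) (hno b hb hbe)
  · exact ⟨s, hs, (key a ha hae s h1).1⟩
  · exact ⟨s, hs, (key b hb hbe s h1).1⟩

lemma IsTree.isResolvingSet_of_leaves (hG : G.IsTree) {S : Set V}
    (hcond : ∀ u x y, x ≠ y → isTerminalOf G u x → isTerminalOf G u y → G.Adj u x)
    (hS : ∀ u x y, x ≠ y → isLeaf G x → isLeaf G y → G.Adj u x → G.Adj u y → x ∈ S ∨ y ∈ S)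
    (hleaf : ∀ s ∈ S, isLeaf G s) (hmaj : ∃ u, isMajor G u) : isResolvingSet G S := by
  intro x y hxy
  by_contra! hcon
  obtain ⟨r, hr⟩ : ∃ r, r ∈ S := by
    obtain ⟨u, hu⟩ := hmaj
    obtain ⟨a, -, ha, -⟩ := hu.exists_adj_ne u
    obtain ⟨s, hs, -⟩ := hG.exists_mem_branch hcond hS ha.symm (self_mem_branch ha.symm) hu
    exact ⟨s, hs⟩
  obtain ⟨m, ⟨hmx, hmy⟩, hmax⟩ := Set.exists_max_image
    {v | G.dist r v + G.dist v x = G.dist r x ∧ G.dist r v + G.dist v y = G.dist r y}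
    (G.dist r) (Set.toFinite _) ⟨r, by simp⟩
  have hrxy := hcon r hr
  have hxm : x ≠ m := by
    rintro rfl
    exact hxy (hG.connected.dist_eq_zero_iff.1 (by omega))
  have hym : y ≠ m := by
    rintro rfl
    exact hxy.symm (hG.connected.dist_eq_zero_iff.1 (by omega))
  obtain ⟨a, ha, hda⟩ := hG.connected.exists_adj_dist_eq hxm.symm
  obtain ⟨b, hb, hdb⟩ := hG.connected.exists_adj_dist_eq hym.symm
  have hxa : x ∈ branch G m a := by rw [mem_branch, dist_comm, hda, dist_comm]
  have hyb : y ∈ branch G m b := by rw [mem_branch, dist_comm, hdb, dist_comm]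
  have hra : r ∉ branch G m a := by
    intro h
    have h1 := hG.connected.dist_triangle (u := r) (v := a) (w := x)
    rw [mem_branch, dist_comm, dist_comm (u := a)] at h
    rw [mem_branch] at hxa
    omega
  have hrb : r ∉ branch G m b := by
    intro h
    have h1 := hG.connected.dist_triangle (u := r) (v := b) (w := y)
    rw [mem_branch, dist_comm, dist_comm (u := b)] at h
    rw [mem_branch] at hyb
    omega
  have hab : a ≠ b := by
    rintro rfl
    have h1 := hG.dist_eq_of_not_mem_branch ha hra
    rw [dist_comm, dist_comm (u := m)] at h1
    rw [mem_branch] at hxa hyb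
    have := hmax a ⟨by omega, by omega⟩
    omega
  have hSa : ∀ s ∈ S, s ∉ branch G m a := by
    intro s hs h
    have h1 := hG.dist_eq_of_mem_branch hb (hG.disjoint_branch ha hb hab h) hyb
    have h2 := hG.connected.dist_triangle (u := s) (v := a) (w := x)
    have h3 := hcon s hs
    rw [mem_branch, dist_comm, dist_comm (u := a)] at h
    rw [mem_branch] at hxa
    omega
  have hSb : ∀ s ∈ S, s ∉ branch G m b := by
    intro s hs h
    have h1 := hG.dist_eq_of_mem_branch ha (hG.disjoint_branch hb ha hab.symm h) hxa
    have h2 := hG.connected.dist_triangle (u := s) (v := b) (w := y)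
    have h3 := hcon s hs
    rw [mem_branch, dist_comm, dist_comm (u := b)] at h
    rw [mem_branch] at hyb
    omega
  have hrm : m ≠ r := by
    rintro rfl
    exact hab ((hleaf m hr).eq_of_adj ha hb)
  obtain ⟨c, hc, hdc⟩ := hG.connected.exists_adj_dist_eq hrm
  have hrc : r ∈ branch G m c := by rw [mem_branch, dist_comm, hdc, dist_comm]
  have hm : isMajor G m := isMajor_of_adj ha hb hc hab
    (by rintro rfl; exact hra hrc) (by rintro rfl; exact hrb hrc)
  obtain ⟨s, hs, h | h⟩ := hG.exists_mem_of_branches hcond hS hm ha hb hab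
    (fun q hq hqm => by
      obtain ⟨s, hs, h⟩ := hG.exists_mem_branch hcond hS ha hq hqm
      exact hSa s hs h)
    (fun q hq hqm => by
      obtain ⟨s, hs, h⟩ := hG.exists_mem_branch hcond hS hb hq hqm
      exact hSb s hs h)
  · exact hSa s hs h
  · exact hSb s hs h

end Branches

section Legs

variable {V : Type*} {G : SimpleGraph V}

/-- The graph on `V` whose edges join the adjacent vertices that are not major. -/
def nonMajorGraph (G : SimpleGraph V) : SimpleGraph V where
  Adj a b := G.Adj a b ∧ ¬ isMajor G a ∧ ¬ isMajor G b
  symm := ⟨fun _ _ h => ⟨h.1.symm, h.2.2, h.2.1⟩⟩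
  loopless := ⟨fun _ h => h.1.ne rfl⟩

variable [Finite V]

lemma Connected.eq_or_adj_geodesic (hG : G.Connected) {u x v : V} (hx : isTerminalOf G u x)
    (hv : G.dist x v + G.dist v u = G.dist x u) (hvm : ¬ isMajor G v) :
    (isLeaf G v → v = x) ∧
      ∀ w, G.Adj v w → G.dist x w + G.dist w u = G.dist x u := by
  have hvu : v ≠ u := by
    rintro rfl
    exact hvm hx.2.1
  obtain ⟨b, hb, hdb⟩ := hG.exists_adj_dist_eq hvu
  rw [dist_comm, dist_comm (v := b)] at hdb
  have hb1 := hG.dist_le_succ_of_adj x hb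
  have hb2 := hG.dist_triangle (u := x) (v := b) (w := u)
  by_cases hvx : v = x
  · subst hvx
    refine ⟨fun _ => rfl, fun w hw => ?_⟩
    rw [hx.1.eq_of_adj hw hb]
    omega
  · obtain ⟨a, ha, hda⟩ := hG.exists_adj_dist_eq hvx
    have ha1 := hG.dist_le_succ_of_adj u ha
    rw [dist_comm, dist_comm (v := v)] at ha1
    have ha2 := hG.dist_triangle (u := x) (v := a) (w := u)
    have hab : a ≠ b := by
      rintro rfl
      omega
    refine ⟨fun hl => absurd (hl.eq_of_adj ha hb) hab, fun w hw => ?_⟩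
    by_cases h1 : a = w
    · subst h1; omega
    by_cases h2 : b = w
    · subst h2; omega
    exact absurd (isMajor_of_adj ha hb hw hab h1 h2) hvm

lemma Connected.leg_geodesic (hG : G.Connected) {u x v : V} (hx : isTerminalOf G u x)
    (hv : (nonMajorGraph G).Reachable x v) :
    G.dist x v + G.dist v u = G.dist x u ∧ ¬ isMajor G v := by
  refine hv.mem_of_closed
    (C := {v | G.dist x v + G.dist v u = G.dist x u ∧ ¬ isMajor G v}) ?_ ?_
  · rintro v ⟨h1, h2⟩ w hw
    exact ⟨(hG.eq_or_adj_geodesic hx h1 h2).2 w hw.1, hw.2.2⟩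
  · exact ⟨by simp, fun h => h.not_isLeaf hx.1⟩

lemma Connected.eq_of_reachable_of_isLeaf (hG : G.Connected) {u x v : V}
    (hx : isTerminalOf G u x) (hv : (nonMajorGraph G).Reachable x v) (hl : isLeaf G v) :
    v = x :=
  (hG.eq_or_adj_geodesic hx (hG.leg_geodesic hx hv).1 (hG.leg_geodesic hx hv).2).1 hl

lemma Connected.reachable_or_eq_of_adj (hG : G.Connected) {u x v w : V}
    (hx : isTerminalOf G u x) (hv : (nonMajorGraph G).Reachable x v) (hw : G.Adj v w) :
    (nonMajorGraph G).Reachable x w ∨ w = u := by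
  obtain ⟨h1, h2⟩ := hG.leg_geodesic hx hv
  by_cases hwm : isMajor G w
  · right
    by_contra hne
    have h3 := (hG.eq_or_adj_geodesic hx h1 h2).2 w hw
    have h4 := hx.2.2 w hwm hne
    rw [dist_comm, dist_comm (u := w)] at h4
    omega
  · left
    have : (nonMajorGraph G).Adj v w := ⟨hw, h2, hwm⟩
    exact hv.trans this.reachable

lemma Connected.dist_leg (hG : G.Connected) {u x z s : V} (hx : isTerminalOf G u x)
    (hz : (nonMajorGraph G).Reachable x z) (hs : ¬ (nonMajorGraph G).Reachable x s) :
    G.dist s z = G.dist s u + G.dist u z := by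
  obtain ⟨a, b, hab, ha, hb, hd⟩ := hG.exists_boundary_dist_eq
    (C := {v | (nonMajorGraph G).Reachable x v}) hs hz
  rcases hG.reachable_or_eq_of_adj hx hb hab.symm with h | h
  · exact absurd h ha
  · rwa [h] at hd

lemma Connected.exists_adj_leg (hG : G.Connected) {u x : V} (hx : isTerminalOf G u x) :
    ∃ z, G.Adj u z ∧ (nonMajorGraph G).Reachable x z := by
  have hu : ¬ (nonMajorGraph G).Reachable x u := fun h => (hG.leg_geodesic hx h).2 hx.2.1
  obtain ⟨a, b, hab, ha, hb, -⟩ := hG.exists_boundary_dist_eq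
    (C := {v | (nonMajorGraph G).Reachable x v}) hu (Reachable.refl x)
  rcases hG.reachable_or_eq_of_adj hx hb hab.symm with h | h
  · exact absurd h ha
  · exact ⟨b, h ▸ hab, hb⟩

/-- A resolving set meets all but at most one of the legs at a major vertex. -/
lemma Connected.exists_mem_leg (hG : G.Connected) {S : Set V} (hS : isResolvingSet G S)
    {u x y : V} (hxy : x ≠ y) (hx : isTerminalOf G u x) (hy : isTerminalOf G u y) :
    ∃ s ∈ S, (nonMajorGraph G).Reachable x s ∨ (nonMajorGraph G).Reachable y s := by
  by_contra! hcon
  obtain ⟨a, ha, hxa⟩ := hG.exists_adj_leg hx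
  obtain ⟨b, hb, hyb⟩ := hG.exists_adj_leg hy
  have hab : a ≠ b := by
    rintro rfl
    exact hxy.symm (hG.eq_of_reachable_of_isLeaf hx (hxa.trans hyb.symm) hy.1)
  obtain ⟨s, hs, hd⟩ := hS a b hab
  apply hd
  rw [hG.dist_leg hx hxa (hcon s hs).1, hG.dist_leg hy hyb (hcon s hs).2,
    dist_eq_one_iff_adj.2 ha, dist_eq_one_iff_adj.2 hb]

end Legs

section Counting

variable {V : Type*} [Fintype V] {G : SimpleGraph V}

lemma Connected.sum_terDeg_le (hG : G.Connected) {S : Set V} (hS : isResolvingSet G S) :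
    ∑ u, (terDeg G u - 1) ≤ S.ncard := by
  classical
  let hit : V → Prop := fun x => ∃ s ∈ S, (nonMajorGraph G).Reachable x s
  let T : V → Finset V := fun u => Finset.univ.filter (isTerminalOf G u)
  have hT : ∀ u, terDeg G u = (T u).card := by
    intro u
    rw [terDeg, ← Set.ncard_coe_finset]
    simp [T]
  have h1 : ∀ u, terDeg G u - 1 ≤ ((T u).filter hit).card := by
    intro u
    have h2 : ((T u).filter fun x => ¬ hit x).card ≤ 1 := by
      refine Finset.card_le_one.2 fun x hx y hy => ?_
      simp only [T, Finset.mem_filter, Finset.mem_univ, true_and] at hx hy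
      by_contra hxy
      obtain ⟨s, hs, h | h⟩ := hG.exists_mem_leg hS hxy hx.1 hy.1
      · exact hx.2 ⟨s, hs, h⟩
      · exact hy.2 ⟨s, hs, h⟩
    have h3 := Finset.card_filter_add_card_filter_not (s := T u) hit
    rw [hT]
    omega
  have hdisj : ((Finset.univ : Finset V) : Set V).PairwiseDisjoint
      fun u => (T u).filter hit := by
    intro u _ v _ huv
    refine Finset.disjoint_left.2 fun x hx hy => huv ?_
    simp only [T, Finset.mem_filter, Finset.mem_univ, true_and] at hx hy
    exact hx.1.unique hy.1
  calc ∑ u, (terDeg G u - 1) ≤ ∑ u, ((T u).filter hit).card := Finset.sum_le_sum fun u _ => h1 u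
    _ = (Finset.univ.biUnion fun u => (T u).filter hit).card := (Finset.card_biUnion hdisj).symm
    _ ≤ S.toFinset.card := by
      have hmem : ∀ x ∈ Finset.univ.biUnion fun u => (T u).filter hit,
          (∃ u, isTerminalOf G u x) ∧ hit x := by
        intro x hx
        simp only [T, Finset.mem_biUnion, Finset.mem_filter, Finset.mem_univ, true_and] at hx
        obtain ⟨u, hu, h⟩ := hx
        exact ⟨⟨u, hu⟩, h⟩
      choose! f hf using fun x (h : hit x) => h
      refine Finset.card_le_card_of_injOn f (fun x hx => ?_) fun x hx y hy hxy => ?_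
      · simpa using (hf x (hmem x hx).2).1
      · obtain ⟨⟨u, hu⟩, hhx⟩ := hmem x hx
        obtain ⟨⟨v, hv⟩, hhy⟩ := hmem y hy
        have h2 := (hf x hhx).2
        rw [hxy] at h2
        exact (hG.eq_of_reachable_of_isLeaf hu (h2.trans (hf y hhy).2.symm) hv.1).symm
    _ = S.ncard := (Set.ncard_eq_toFinset_card' S).symm

/-- The number of leaves adjacent to a vertex. -/
noncomputable def leafDeg (G : SimpleGraph V) (u : V) : ℕ := {x | isLeaf G x ∧ G.Adj u x}.ncard

lemma numStrongLeaves_sub_ncard :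
    numStrongLeaves G - {u : V | isStrongSupport G u}.ncard = ∑ u, (leafDeg G u - 1) := by
  classical
  let A : V → Finset V := fun u => Finset.univ.filter fun x => isLeaf G x ∧ G.Adj u x
  let E : Finset V := Finset.univ.filter (isStrongSupport G)
  have hA : ∀ u, leafDeg G u = (A u).card := by
    intro u
    rw [leafDeg, ← Set.ncard_coe_finset]
    simp [A]
  have hE : {u : V | isStrongSupport G u}.ncard = E.card := by
    rw [← Set.ncard_coe_finset]
    simp [E]
  have hdisj : (E : Set V).PairwiseDisjoint A := by
    intro u _ v _ huv
    refine Finset.disjoint_left.2 fun x hx hy => huv ?_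
    simp only [A, Finset.mem_filter, Finset.mem_univ, true_and] at hx hy
    exact hx.1.eq_of_adj hx.2.symm hy.2.symm
  have hL : numStrongLeaves G = ∑ u ∈ E, (A u).card := by
    rw [← Finset.card_biUnion hdisj, numStrongLeaves, ← Set.ncard_coe_finset]
    congr 1
    ext x
    simp only [A, E, Set.mem_ofPred_eq, Finset.coe_biUnion, Set.mem_iUnion, Finset.mem_coe,
      Finset.mem_filter, Finset.mem_univ, true_and]
    exact ⟨fun ⟨h, u, hu, hux⟩ => ⟨u, hu, h, hux⟩, fun ⟨u, hu, h, hux⟩ => ⟨h, u, hu, hux⟩⟩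
  have hsplit : ∑ u ∈ E, (A u).card = ∑ u ∈ E, (leafDeg G u - 1) + E.card := by
    rw [Finset.card_eq_sum_ones, ← Finset.sum_add_distrib]
    refine Finset.sum_congr rfl fun u hu => ?_
    have : 2 ≤ leafDeg G u := (Finset.mem_filter.1 hu).2
    rw [← hA]
    omega
  rw [hL, hE, hsplit, Nat.add_sub_cancel]
  refine Finset.sum_subset (Finset.subset_univ _) fun u _ hu => ?_
  have : ¬ 2 ≤ leafDeg G u := fun h => hu (Finset.mem_filter.2 ⟨Finset.mem_univ _, h⟩)
  omega

/-- All but one of the leaves at each support vertex. -/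
lemma exists_leaf_set : ∃ S : Set V, S.ncard ≤ ∑ u, (leafDeg G u - 1) ∧
    (∀ s ∈ S, isLeaf G s) ∧
    ∀ u x y, x ≠ y → isLeaf G x → isLeaf G y → G.Adj u x → G.Adj u y → x ∈ S ∨ y ∈ S := by
  classical
  let A : V → Finset V := fun u => Finset.univ.filter fun x => isLeaf G x ∧ G.Adj u x
  have hA : ∀ u, leafDeg G u = (A u).card := by
    intro u
    rw [leafDeg, ← Set.ncard_coe_finset]
    simp [A]
  have hc : ∀ u, ∃ c, (A u).Nonempty → c ∈ A u := by
    intro u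
    by_cases h : (A u).Nonempty
    · exact ⟨h.choose, fun _ => h.choose_spec⟩
    · exact ⟨u, fun h' => absurd h' h⟩
  choose c hc using hc
  refine ⟨(Finset.univ.biUnion fun u => (A u).erase (c u) : Finset V), ?_, ?_, ?_⟩
  · rw [Set.ncard_coe_finset]
    refine Finset.card_biUnion_le.trans (Finset.sum_le_sum fun u _ => ?_)
    rw [hA]
    rcases (A u).eq_empty_or_nonempty with h | h
    · simp [h]
    · rw [Finset.card_erase_of_mem (hc u h)]
  · intro s hs
    simp only [A, Finset.coe_biUnion, Set.mem_iUnion, Finset.mem_coe, Finset.mem_erase,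
      Finset.mem_filter] at hs
    obtain ⟨u, -, -, -, h, -⟩ := hs
    exact h
  · intro u x y hxy hx hy hux huy
    simp only [Finset.mem_coe, Finset.mem_biUnion, Finset.mem_univ, true_and, Finset.mem_erase]
    by_cases h : x = c u
    · exact Or.inr ⟨u, fun h' => hxy (h.trans h'.symm), by simp [A, hy, huy]⟩
    · exact Or.inl ⟨u, h, by simp [A, hx, hux]⟩

end Counting

section Path

variable {V : Type*} [Fintype V] {G : SimpleGraph V}

/-- A tree that is not a path has a major vertex. -/
lemma IsTree.exists_isMajor (hG : G.IsTree) (hcard : 2 ≤ Fintype.card V)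
    (hnp : ¬ isPathGraph G) : ∃ u, isMajor G u := by
  classical
  by_contra! hno
  have : Nontrivial V := Fintype.one_lt_card_iff_nontrivial.1 hcard
  obtain ⟨r, hr⟩ := hG.exists_vert_degree_one_of_nontrivial
  have hleaf : isLeaf G r := by
    rw [isLeaf, Set.ncard_eq_toFinset_card', ← hr]
    rfl
  have hinj : ∀ k v w, G.dist r v = k → G.dist r w = k → v = w := by
    intro k
    induction k with
    | zero =>
      intro v w hv hw
      rw [← hG.connected.dist_eq_zero_iff.1 hv, ← hG.connected.dist_eq_zero_iff.1 hw]
    | succ k ih =>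
      intro v w hv hw
      have hvr : v ≠ r := by rintro rfl; simp at hv
      have hwr : w ≠ r := by rintro rfl; simp at hw
      obtain ⟨a, ha, hda⟩ := hG.connected.exists_adj_dist_eq hvr
      obtain ⟨b, hb, hdb⟩ := hG.connected.exists_adj_dist_eq hwr
      obtain rfl := ih a b (by omega) (by omega)
      by_contra hvw
      by_cases har : a = r
      · subst har
        exact hvw (hleaf.eq_of_adj ha.symm hb.symm)
      · obtain ⟨e, he, hde⟩ := hG.connected.exists_adj_dist_eq har
        refine hno a (isMajor_of_adj ha.symm hb.symm he hvw ?_ ?_)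
        · rintro rfl; omega
        · rintro rfl; omega
  have hlt : ∀ v, G.dist r v < Fintype.card V := by
    intro v
    obtain ⟨p, hp, hl⟩ := hG.connected.exists_path_of_dist r v
    exact hl ▸ hp.length_lt
  let f : V → Fin (Fintype.card V) := fun v => ⟨G.dist r v, hlt v⟩
  have hf : Function.Bijective f := by
    refine (Fintype.bijective_iff_injective_and_card f).2 ⟨fun v w h => ?_, by simp⟩
    exact hinj _ v w rfl (congrArg Fin.val h).symm
  have hadj : ∀ v w, G.dist r v + 1 = G.dist r w → G.Adj v w := by
    intro v w h
    have hwr : w ≠ r := by rintro rfl; simp at h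
    obtain ⟨a, ha, hda⟩ := hG.connected.exists_adj_dist_eq hwr
    rw [hinj _ v a rfl (by omega)]
    exact ha.symm
  refine hnp ⟨Fintype.card V, ⟨⟨Equiv.ofBijective f hf, fun {v w} => ?_⟩⟩⟩
  rw [pathGraph_adj]
  change G.dist r v + 1 = G.dist r w ∨ G.dist r w + 1 = G.dist r v ↔ G.Adj v w
  refine ⟨fun h => h.elim (hadj v w) fun h => (hadj w v h).symm, fun h => ?_⟩
  have := hG.dist_eq_dist_add_one_of_adj r h
  omega

lemma IsTree.isMajor_of_adj_leaves (hG : G.IsTree) (hmaj : ∃ u, isMajor G u) {u x y : V}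
    (hxy : x ≠ y) (hx : isLeaf G x) (hy : isLeaf G y) (hux : G.Adj u x) (huy : G.Adj u y) :
    isMajor G u := by
  by_contra hu
  obtain ⟨m, hm⟩ := hmaj
  have h : m ∈ ({u, x, y} : Set V) := by
    refine (hG.connected u m).mem_of_closed ?_ (by simp)
    rintro v (rfl | rfl | rfl) w hw
    · by_contra h
      simp only [Set.mem_insert_iff, Set.mem_singleton_iff, not_or] at h
      exact hu (isMajor_of_adj hux huy hw hxy (Ne.symm h.2.1) (Ne.symm h.2.2))
    · exact Or.inl (hx.eq_of_adj hw hux.symm)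
    · exact Or.inl (hy.eq_of_adj hw huy.symm)
  rcases h with rfl | rfl | rfl
  · exact hu hm
  · exact hm.not_isLeaf hx
  · exact hm.not_isLeaf hy

lemma IsTree.leafDeg_sub_one_le (hG : G.IsTree) (hmaj : ∃ u, isMajor G u) (u : V) :
    leafDeg G u - 1 ≤ terDeg G u - 1 := by
  by_cases h : 1 < leafDeg G u
  · obtain ⟨x, y, hx, hy, hxy⟩ := (Set.one_lt_ncard_iff).1 h
    have hu := hG.isMajor_of_adj_leaves hmaj hxy hx.1 hy.1 hx.2 hy.2
    exact Nat.sub_le_sub_right (Set.ncard_le_ncard fun z hz =>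
      hu.isTerminalOf_of_adj hG.connected hz.1 hz.2) 1
  · omega

lemma isMajor.leafDeg_lt (hG : G.Connected) {u x : V} (hu : isMajor G u)
    (hx : isTerminalOf G u x) (hux : ¬ G.Adj u x) : leafDeg G u < terDeg G u :=
  Set.ncard_lt_ncard ⟨fun _ hz => hu.isTerminalOf_of_adj hG hz.1 hz.2, fun h => hux (h hx).2⟩

end Path

end SimpleGraph

theorem stmt3 {V : Type*} [Fintype V] (G : SimpleGraph V)
    (htree : G.IsTree) (hcard : 2 ≤ Fintype.card V) (hnp : ¬ isPathGraph G) :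
    metricDim G = numStrongLeaves G - {u : V | isStrongSupport G u}.ncard ↔
      ∀ u : V, isMajor G u → 2 ≤ terDeg G u →
        ∀ x : V, isTerminalOf G u x → G.Adj u x := by
  have hmaj := htree.exists_isMajor hcard hnp
  have hne : {n | ∃ S : Set V, isResolvingSet G S ∧ S.ncard = n}.Nonempty :=
    ⟨_, Set.univ, fun x y hxy => ⟨x, Set.mem_univ x, by
      rw [SimpleGraph.dist_self]
      exact (htree.connected.pos_dist_of_ne hxy).ne⟩, rfl⟩
  obtain ⟨R, hR, hRdim⟩ := Nat.sInf_mem hne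
  have hlower : ∑ u, (terDeg G u - 1) ≤ metricDim G :=
    (htree.connected.sum_terDeg_le hR).trans hRdim.le
  rw [numStrongLeaves_sub_ncard]
  constructor
  · intro hdim u hu hter x hx
    by_contra hux
    have hlt : ∑ v, (leafDeg G v - 1) < ∑ v, (terDeg G v - 1) :=
      Finset.sum_lt_sum (fun v _ => htree.leafDeg_sub_one_le hmaj v)
        ⟨u, Finset.mem_univ u, by
          have := hu.leafDeg_lt htree.connected hx hux
          omega⟩
    omega
  · intro hcond
    obtain ⟨S, hcardS, hleaf, hS⟩ := exists_leaf_set (G := G)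
    have hres : isResolvingSet G S := by
      refine htree.isResolvingSet_of_leaves (fun u x y hxy hx hy => ?_) hS hleaf hmaj
      have hter : 1 < {z | isTerminalOf G u z}.ncard :=
        (Set.one_lt_ncard_iff (Set.toFinite _)).2 ⟨x, y, hx, hy, hxy⟩
      exact hcond u hx.2.1 hter x hx
    have hdim : metricDim G ≤ S.ncard := Nat.sInf_le ⟨S, hres, rfl⟩
    refine le_antisymm (hdim.trans hcardS) ?_
    exact (Finset.sum_le_sum fun u _ => htree.leafDeg_sub_one_le hmaj u).trans hlower
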